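/- Let B be an even simple Bratteli diagram with full group G=G_B=⋃_n G_n and path space X=X_B, let A⊊X be clopen, and for n≥1 let G°_n(A)=G_n∩G°(A). Then for every invariant random subgroup φ of G, one has lim_{n→∞} (1/|G°_n(A)|) Σ_{g∈G°_n(A)} φ(Fix_{Sub(G)}(g)) = φ(F(A)), where Fix_{Sub(G)}(g)={H∈Sub(G) : gHg⁻¹=H}, and the convergence is monotone. -/

import Mathlib

open MeasureTheory Filter
open scoped ENNReal ComplexOrder

noncomputable section

/-- A Bratteli diagram: vertex levels `V i`, edge levels `E i` (edges from `V i` to `V (i+1)`),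
all levels finite and nonempty, a single root vertex, and source/range maps that are
surjective (every vertex emits and receives an edge). -/
structure BratteliDiagram where
  V : ℕ → Type
  E : ℕ → Type
  fintypeV : ∀ i, Fintype (V i)
  fintypeE : ∀ i, Fintype (E i)
  nonemptyV : ∀ i, Nonempty (V i)
  nonemptyE : ∀ i, Nonempty (E i)
  subsingleton_root : Subsingleton (V 0)
  src : ∀ i, E i → V i
  rng : ∀ i, E i → V (i + 1)
  src_surj : ∀ i, Function.Surjective (src i)
  rng_surj : ∀ i, Function.Surjective (rng i)

namespace BratteliDiagram

variable (B : BratteliDiagram)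

/-- The path space `X_B`: infinite paths starting at the root. -/
def Path : Type :=
  { x : ∀ i, B.E i // ∀ i, B.rng i (x i) = B.src (i + 1) (x (i + 1)) }

instance (i : ℕ) : UniformSpace (B.E i) := ⊥

instance instUniformSpacePath : UniformSpace B.Path :=
  inferInstanceAs (UniformSpace { x : ∀ i, B.E i // ∀ i, B.rng i (x i) = B.src (i + 1) (x (i + 1)) })

instance instMeasurableSpacePath : MeasurableSpace B.Path := borel _

/-- Finite segments of `L+1` consecutive edges starting at level `n`. -/
def Seg (n L : ℕ) : Type :=
  { f : ∀ i : Fin (L + 1), B.E (n + (i : ℕ)) //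
    ∀ (i : ℕ) (hi : i < L),
      B.rng (n + i) (f ⟨i, by omega⟩) = B.src (n + (i + 1)) (f ⟨i + 1, by omega⟩) }

/-- The number of finite paths connecting `v ∈ V n` to `w ∈ V (n + L + 1)`. -/
def numPaths (n L : ℕ) (v : B.V n) (w : B.V (n + L + 1)) : ℕ :=
  Nat.card { f : B.Seg n L //
    B.src n (f.1 ⟨0, by omega⟩) = v ∧ B.rng (n + L) (f.1 ⟨L, by omega⟩) = w }

/-- A Bratteli diagram is simple if every vertex of a given level is connected
to every vertex of some deeper level. -/
def IsSimple : Prop :=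
  ∀ n : ℕ, ∃ L : ℕ, ∀ (v : B.V n) (w : B.V (n + L + 1)), 0 < B.numPaths n L v w

/-- A Bratteli diagram is even if every vertex of a given level is connected to every
vertex of some deeper level by a (positive) even number of paths. -/
def IsEven : Prop :=
  ∀ n : ℕ, ∃ L : ℕ, ∀ (v : B.V n) (w : B.V (n + L + 1)),
    0 < B.numPaths n L v w ∧ Even (B.numPaths n L v w)

/-- A permutation of the path space "of level `n`": it changes only the first `n` edges,
and what it does to the first `n` edges depends only on the first `n` edges. -/
def IsLevel (n : ℕ) (g : Equiv.Perm B.Path) : Prop :=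
  (∀ (x : B.Path) (i : ℕ), n ≤ i → (g x).1 i = x.1 i) ∧
  (∀ x y : B.Path, (∀ i : ℕ, i < n → x.1 i = y.1 i) → ∀ i : ℕ, i < n → (g x).1 i = (g y).1 i)

theorem isLevel_one (n : ℕ) : B.IsLevel n 1 :=
  ⟨fun _ _ _ => rfl, fun _ _ h i hi => h i hi⟩

theorem IsLevel.mul {n : ℕ} {a b : Equiv.Perm B.Path} (ha : B.IsLevel n a)
    (hb : B.IsLevel n b) : B.IsLevel n (a * b) := by
  constructor
  · intro x i hi
    have h1 := ha.1 (b x) i hi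
    have h2 := hb.1 x i hi
    simpa [Equiv.Perm.mul_apply] using h1.trans h2
  · intro x y hxy i hi
    have h2 := hb.2 x y hxy
    have := ha.2 (b x) (b y) h2 i hi
    simpa [Equiv.Perm.mul_apply] using this

theorem IsLevel.mono {n m : ℕ} (hnm : n ≤ m) {g : Equiv.Perm B.Path}
    (h : B.IsLevel n g) : B.IsLevel m g := by
  refine ⟨fun x i hi => h.1 x i (hnm.trans hi), fun x y hxy i hi => ?_⟩
  rcases lt_or_ge i n with h' | h'
  · exact h.2 x y (fun j hj => hxy j (hj.trans_le hnm)) i h'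
  · rw [h.1 x i h', h.1 y i h']
    exact hxy i hi

/-- The group `G_n` of homeomorphisms of the path space permuting only the
first `n` edges of infinite paths. -/
def level (n : ℕ) : Subgroup (Equiv.Perm B.Path) where
  carrier := { g | B.IsLevel n g ∧ B.IsLevel n g⁻¹ }
  one_mem' := ⟨B.isLevel_one n, by simpa using B.isLevel_one n⟩
  mul_mem' := by
    intro a b ha hb
    exact ⟨ha.1.mul B hb.1, by rw [mul_inv_rev]; exact IsLevel.mul B hb.2 ha.2⟩
  inv_mem' := by
    intro a ha
    exact ⟨ha.2, by simpa using ha.1⟩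

theorem level_mono {n m : ℕ} (h : n ≤ m) : B.level n ≤ B.level m := by
  intro g hg
  exact ⟨hg.1.mono B h, hg.2.mono B h⟩

/-- The full group `G_B = ⋃ n, G_n` of the Bratteli diagram. -/
def fullGroup : Subgroup (Equiv.Perm B.Path) where
  carrier := { g | ∃ n, g ∈ B.level n }
  one_mem' := ⟨0, one_mem _⟩
  mul_mem' := by
    rintro a b ⟨n, ha⟩ ⟨m, hb⟩
    exact ⟨max n m, mul_mem (B.level_mono (le_max_left n m) ha)
      (B.level_mono (le_max_right n m) hb)⟩
  inv_mem' := by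
    rintro a ⟨n, ha⟩
    exact ⟨n, inv_mem ha⟩

/-- `G_n` viewed as a subgroup of the full group. -/
def levelIn (n : ℕ) : Subgroup ↥B.fullGroup := (B.level n).comap B.fullGroup.subtype

/-- The subgroup `G°(A)` of elements of the full group fixing `A` pointwise. -/
def Gcirc (A : Set B.Path) : Subgroup ↥B.fullGroup :=
  ⨅ x ∈ A, MulAction.stabilizer ↥B.fullGroup x

/-- `G°_n(A) = G_n ∩ G°(A)`. -/
def GcircN (n : ℕ) (A : Set B.Path) : Subgroup ↥B.fullGroup :=
  B.levelIn n ⊓ B.Gcirc A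

end BratteliDiagram

/-- Conjugation of a subgroup: `g • H = gHg⁻¹`. -/
def conjSub {Γ : Type*} [Group Γ] (g : Γ) (H : Subgroup Γ) : Subgroup Γ :=
  Subgroup.map (MulAut.conj g).toMonoidHom H

/-- The Borel structure on the space `Sub(Γ)` of subgroups of `Γ`,
induced from the product space `{0,1}^Γ` (equivalently `Set Γ`). -/
instance subgroupMeasurableSpace {Γ : Type*} [Group Γ] : MeasurableSpace (Subgroup Γ) :=
  MeasurableSpace.comap (fun H => (H : Set Γ)) inferInstance

namespace BratteliDiagram

variable (B : BratteliDiagram)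

/-- `F(A)`: the collection of subgroups of the full group normalized by `G°(A)`. -/
def FF (A : Set B.Path) : Set (Subgroup ↥B.fullGroup) :=
  { H | ∀ g ∈ B.Gcirc A, conjSub g H = H }

end BratteliDiagram

/-- A measure `ν` on `Y` is invariant under the action of `G`. -/
def MeasInv (G : Type*) [Group G] {Y : Type*} [MeasurableSpace Y] [MulAction G Y]
    (ν : Measure Y) : Prop :=
  ∀ (g : G) (s : Set Y), MeasurableSet s → ν ((fun y => g • y) ⁻¹' s) = ν s

/-- The action of `G` on `(Y, ν)` is ergodic: every invariant measurable set is null or conull. -/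
def MeasErg (G : Type*) [Group G] {Y : Type*} [MeasurableSpace Y] [MulAction G Y]
    (ν : Measure Y) : Prop :=
  ∀ s : Set Y, MeasurableSet s → (∀ g : G, (fun y => g • y) ⁻¹' s = s) → ν s = 0 ∨ ν s = 1

/-- An invariant random subgroup: a conjugation-invariant Borel probability measure on `Sub(G)`. -/
def IsIRS (G : Type*) [Group G] (φ : Measure (Subgroup G)) : Prop :=
  IsProbabilityMeasure φ ∧
    ∀ (g : G) (s : Set (Subgroup G)), MeasurableSet s → φ (conjSub g ⁻¹' s) = φ s

/-- An ergodic invariant random subgroup. -/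
def IsErgodicIRS (G : Type*) [Group G] (φ : Measure (Subgroup G)) : Prop :=
  IsIRS G φ ∧
    ∀ s : Set (Subgroup G), MeasurableSet s → (∀ g : G, conjSub g ⁻¹' s = s) →
      φ s = 0 ∨ φ s = 1

/-- A character of a group: normalized, central, positive semidefinite complex function. -/
def IsCharacter (G : Type*) [Group G] (χ : G → ℂ) : Prop :=
  χ 1 = 1 ∧ (∀ a b : G, χ (a * b) = χ (b * a)) ∧
    ∀ (n : ℕ) (g : Fin n → G) (c : Fin n → ℂ),
      0 ≤ ∑ i, ∑ j, (starRingEnd ℂ) (c i) * c j * χ (g i * (g j)⁻¹)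

namespace BratteliDiagram

variable (B : BratteliDiagram)

/-- The product measure `μ_α = μ_1^{α_1} × ⋯ × μ_k^{α_k}` on `X^{|α|}`,
realized on the index type `Σ i : Fin k, Fin (α i)` (of cardinality `|α| = Σ α i`). -/
def prodMeasure {k : ℕ} (μ : Fin k → Measure B.Path) (α : Fin k → ℕ) :
    Measure ((Σ i : Fin k, Fin (α i)) → B.Path) :=
  Measure.pi fun p => μ p.1

/-- The stabilizer distribution `φ_α` of the diagonal action of the full group
on `(X^{|α|}, μ_α)`. -/
def stabDist {k : ℕ} (μ : Fin k → Measure B.Path) (α : Fin k → ℕ) :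
    Measure (Subgroup ↥B.fullGroup) :=
  Measure.map (fun y => MulAction.stabilizer ↥B.fullGroup y) (B.prodMeasure μ α)

end BratteliDiagram

theorem relIndex_unbounded {Γ : Type*} [Group Γ] (K : ℕ → Subgroup Γ) (hmono : Monotone K)
    (Kω : Subgroup Γ) (hle : ∀ n, K n ≤ Kω) (hun : ∀ g ∈ Kω, ∃ n, g ∈ K n)
    (hfin : ∀ n, Finite (K n)) (N : Subgroup Γ) (h0 : N.relIndex Kω = 0) (r : ℕ) :
    ∃ n, r ≤ N.relIndex (K n) := by
  classical
  have hinf : Infinite (Kω ⧸ N.subgroupOf Kω) := by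
    by_contra hc
    rw [not_infinite_iff_finite] at hc
    exact (Nat.card_pos (α := Kω ⧸ N.subgroupOf Kω)).ne' h0
  obtain ⟨s, hs⟩ := Infinite.exists_subset_card_eq (Kω ⧸ N.subgroupOf Kω) r
  choose ν hν using hun
  let n := s.sup (fun q => ν (q.out : Γ) q.out.2)
  have hmem : ∀ q ∈ s, (q.out : Γ) ∈ K n := fun q hq =>
    hmono (Finset.le_sup (f := fun q : Kω ⧸ N.subgroupOf Kω => ν (q.out : Γ) q.out.2) hq) (hν _ _)
  refine ⟨n, ?_⟩
  have := hfin n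
  let φ : s → (K n ⧸ N.subgroupOf (K n)) := fun q =>
    QuotientGroup.mk ⟨(q.1.out : Γ), hmem q.1 q.2⟩
  have hφ : Function.Injective φ := by
    intro a b hab
    have h1 := congrArg (Subgroup.quotientSubgroupOfEmbeddingOfLE N (hle n)) hab
    simp only [φ, Subgroup.quotientSubgroupOfEmbeddingOfLE_apply_mk] at h1
    have h2 : ∀ q : s, (Subgroup.inclusion (hle n) ⟨(q.1.out : Γ), hmem q.1 q.2⟩) = q.1.out :=
      fun q => rfl
    rw [h2, h2] at h1
    apply Subtype.ext
    simpa using h1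
  have := Nat.card_le_card_of_injective φ hφ
  rw [← hs]
  simpa [Subgroup.relIndex, Subgroup.index] using this

/-- The conjugation stabilizer of a subgroup. -/
def conjStab {Γ : Type*} [Group Γ] (H : Subgroup Γ) : Subgroup Γ where
  carrier := {g | conjSub g H = H}
  one_mem' := by
    ext x; simp [conjSub]
  mul_mem' := by
    intro a b ha hb
    simp only [Set.mem_ofPred_eq, conjSub] at *
    conv_rhs => rw [← ha, ← hb]
    rw [Subgroup.map_map]
    congr 1
    ext; simp
  inv_mem' := by
    intro a ha
    simp only [Set.mem_ofPred_eq, conjSub] at *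
    conv_lhs => rw [← ha]
    rw [Subgroup.map_map]
    ext x; simp [mul_assoc]

theorem mem_conjStab {Γ : Type*} [Group Γ] (H : Subgroup Γ) (g : Γ) :
    g ∈ conjStab H ↔ conjSub g H = H := Iff.rfl

theorem measurableSet_conjFix {Γ : Type*} [Group Γ] [Countable Γ] (g : Γ) :
    MeasurableSet {H : Subgroup Γ | conjSub g H = H} := by
  have hm : ∀ x : Γ, MeasurableSet {H : Subgroup Γ | x ∈ H} := fun x =>
    (comap_measurable (fun H : Subgroup Γ => (H : Set Γ))) (measurableSet_mem x)
  have : {H : Subgroup Γ | conjSub g H = H} =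
      ⋂ x : Γ, {H : Subgroup Γ | g⁻¹ * x * g ∈ H ↔ x ∈ H} := by
    ext H
    simp only [Set.mem_ofPred_eq, Set.mem_iInter, SetLike.ext_iff]
    refine forall_congr' fun x => ?_
    have : x ∈ conjSub g H ↔ g⁻¹ * x * g ∈ H := by
      simp only [conjSub, Subgroup.mem_map, MulEquiv.coe_toMonoidHom, MulAut.conj_apply]
      constructor
      · rintro ⟨y, hy, rfl⟩
        simpa [mul_assoc] using hy
      · intro h
        exact ⟨_, h, by simp [mul_assoc]⟩
    rw [this]
  rw [this]
  refine MeasurableSet.iInter fun x => ?_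
  have h1 := hm (g⁻¹ * x * g)
  have h2 := hm x
  have : {H : Subgroup Γ | g⁻¹ * x * g ∈ H ↔ x ∈ H} =
    ({H : Subgroup Γ | g⁻¹ * x * g ∈ H} ∩ {H : Subgroup Γ | x ∈ H}) ∪
    ({H : Subgroup Γ | g⁻¹ * x * g ∈ H}ᶜ ∩ {H : Subgroup Γ | x ∈ H}ᶜ) := by
    ext H
    simp only [Set.mem_ofPred_eq, Set.mem_union, Set.mem_inter_iff, Set.mem_compl_iff]
    tauto
  rw [this]
  exact (h1.inter h2).union (h1.compl.inter h2.compl)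

theorem abstract_average {Γ : Type*} [Group Γ] [Countable Γ] (K : ℕ → Subgroup Γ)
    (hmono : Monotone K)
    (Kω : Subgroup Γ) (hle : ∀ n, K n ≤ Kω) (hun : ∀ g ∈ Kω, ∃ n, g ∈ K n)
    (hfin : ∀ n, Finite (K n)) (hN : ∀ N : Subgroup Γ, N.relIndex Kω ≠ 0 → Kω ≤ N)
    (φ : Measure (Subgroup Γ)) [IsProbabilityMeasure φ] :
    Filter.Tendsto
      (fun n : ℕ =>
        (∑ᶠ g : ↥(K n),
            (φ {H : Subgroup Γ | conjSub (g : Γ) H = H}).toReal)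
          / (Nat.card ↥(K n) : ℝ))
      Filter.atTop
      (nhds ((φ {H | ∀ g ∈ Kω, conjSub g H = H}).toReal)) ∧
    Antitone (fun n : ℕ =>
        (∑ᶠ g : ↥(K n),
            (φ {H : Subgroup Γ | conjSub (g : Γ) H = H}).toReal)
          / (Nat.card ↥(K n) : ℝ)) := by
  classical
  let c : ℕ → Subgroup Γ → ℝ := fun n H => ((conjStab H).relIndex (K n) : ℝ)⁻¹
  have hpos : ∀ n H, 0 < (conjStab H).relIndex (K n) := fun n H => by
    have := hfin n
    exact Nat.card_pos (α := K n ⧸ (conjStab H).subgroupOf (K n))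
  have hidx : ∀ (H : Subgroup Γ) {a b : ℕ}, a ≤ b →
      (conjStab H).relIndex (K a) ≤ (conjStab H).relIndex (K b) := fun H a b hab =>
    Subgroup.relIndex_le_of_le_right (hmono hab) (hpos b H).ne'
  have hcsum : ∀ n H, c n H =
      (∑ᶠ g : ↥(K n), Set.indicator {H : Subgroup Γ | conjSub (g : Γ) H = H} (fun _ => (1:ℝ)) H)
        / (Nat.card ↥(K n) : ℝ) := by
    intro n H
    have := hfin n
    have := Fintype.ofFinite (K n)
    rw [finsum_eq_sum_of_fintype]
    have h1 : (∑ g : ↥(K n), Set.indicator {H : Subgroup Γ | conjSub (g : Γ) H = H}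
        (fun _ => (1:ℝ)) H) = Nat.card ((conjStab H).subgroupOf (K n)) := by
      simp only [Set.indicator_apply, Set.mem_ofPred_eq]
      rw [Finset.sum_boole, Nat.card_eq_fintype_card, Fintype.card_subtype]
      congr 2
    have h2 := Subgroup.card_mul_index ((conjStab H).subgroupOf (K n))
    rw [h1, ← h2]
    have hp : 0 < Nat.card ((conjStab H).subgroupOf (K n)) := Nat.card_pos
    have hi := hpos n H
    simp only [c, Subgroup.relIndex] at hi ⊢
    push_cast
    have : (0:ℝ) < Nat.card ((conjStab H).subgroupOf (K n)) := by exact_mod_cast hp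
    have : (0:ℝ) < ((conjStab H).subgroupOf (K n)).index := by exact_mod_cast hi
    field_simp
  have hmeas : ∀ n, Measurable (c n) := by
    intro n
    have := hfin n
    have := Fintype.ofFinite (K n)
    have : c n = fun H => (∑ g : ↥(K n), Set.indicator {H : Subgroup Γ | conjSub (g : Γ) H = H}
        (fun _ => (1:ℝ)) H) / (Nat.card ↥(K n) : ℝ) := by
      funext H; rw [hcsum, finsum_eq_sum_of_fintype]
    rw [this]
    refine Measurable.div_const (Finset.measurable_sum _ fun g _ => ?_) _
    exact measurable_const.indicator (measurableSet_conjFix _)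
  have hc0 : ∀ n H, 0 ≤ c n H := fun n H => by simp only [c]; positivity
  have hc1 : ∀ n H, c n H ≤ 1 := fun n H => by
    simp only [c]
    exact inv_le_one_of_one_le₀ (by exact_mod_cast hpos n H)
  have hint : ∀ n, Integrable (c n) φ := fun n =>
    Integrable.of_bound (hmeas n).aestronglyMeasurable 1
      (Filter.Eventually.of_forall fun H => by
        rw [Real.norm_eq_abs, abs_of_nonneg (hc0 n H)]; exact hc1 n H)
  have havg : (fun n : ℕ => (∑ᶠ g : ↥(K n),
            (φ {H : Subgroup Γ | conjSub (g : Γ) H = H}).toReal)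
          / (Nat.card ↥(K n) : ℝ)) = fun n => ∫ H, c n H ∂φ := by
    funext n
    have := hfin n
    have := Fintype.ofFinite (K n)
    simp_rw [hcsum, finsum_eq_sum_of_fintype]
    rw [integral_div, integral_finsetSum]
    · congr 1
      refine Finset.sum_congr rfl fun g _ => ?_
      rw [integral_indicator (measurableSet_conjFix _)]
      simp [Measure.real]
    · intro g _
      exact (integrable_const _).indicator (measurableSet_conjFix _)
  have hFmeas : MeasurableSet {H : Subgroup Γ | ∀ g ∈ Kω, conjSub g H = H} := by
    have : {H : Subgroup Γ | ∀ g ∈ Kω, conjSub g H = H} =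
        ⋂ g : Kω, {H : Subgroup Γ | conjSub (g : Γ) H = H} := by
      ext H; simp
    rw [this]
    exact MeasurableSet.iInter fun g => measurableSet_conjFix _
  rw [havg]
  constructor
  · have hlim : (φ {H | ∀ g ∈ Kω, conjSub g H = H}).toReal =
        ∫ H, Set.indicator {H | ∀ g ∈ Kω, conjSub g H = H} (fun _ => (1:ℝ)) H ∂φ := by
      rw [integral_indicator hFmeas]
      simp [Measure.real]
    rw [hlim]
    refine tendsto_integral_of_dominated_convergence (fun _ => (1:ℝ))
      (fun n => (hmeas n).aestronglyMeasurable) (integrable_const _)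
      (fun n => Filter.Eventually.of_forall fun H => by
        rw [Real.norm_eq_abs, abs_of_nonneg (hc0 n H)]; exact hc1 n H)
      (Filter.Eventually.of_forall fun H => ?_)
    by_cases hH : ∀ g ∈ Kω, conjSub g H = H
    · rw [Set.indicator_of_mem (by exact hH)]
      have : (fun n => c n H) = fun _ => 1 := by
        funext n
        have : (conjStab H).relIndex (K n) = 1 :=
          Subgroup.relIndex_eq_one.2 fun g hg => hH g (hle n hg)
        simp [c, this]
      rw [this]
      exact tendsto_const_nhds
    · rw [Set.indicator_of_notMem (by exact hH)]
      have h0 : (conjStab H).relIndex Kω = 0 := by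
        by_contra hc
        exact hH (fun g hg => hN _ hc hg)
      have htop : Tendsto (fun n => (conjStab H).relIndex (K n)) atTop atTop :=
        tendsto_atTop_atTop_of_monotone (fun a b hab => hidx H hab)
          (fun r => relIndex_unbounded K hmono Kω hle hun hfin _ h0 r)
      exact tendsto_inv_atTop_zero.comp (tendsto_natCast_atTop_atTop.comp htop)
  · intro a b hab
    refine integral_mono (hint b) (hint a) fun H => ?_
    simp only [c]
    exact inv_anti₀ (by exact_mod_cast hpos a H) (by exact_mod_cast hidx H hab)
theorem exists_perm_three {D : Type*} {a b c x y z : D} (hab : a ≠ b) (hac : a ≠ c) (hbc : b ≠ c)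
    (hxy : x ≠ y) (hxz : x ≠ z) (hyz : y ≠ z) :
    ∃ π : Equiv.Perm D, π a = x ∧ π b = y ∧ π c = z := by
  classical
  let e : Fin 3 ↪ D := ⟨![a, b, c], by
    intro i j h; fin_cases i <;> fin_cases j <;> simp_all⟩
  let f : Fin 3 ↪ D := ⟨![x, y, z], by
    intro i j h; fin_cases i <;> fin_cases j <;> simp_all⟩
  have := Equiv.Perm.isMultiplyPretransitive D 3
  obtain ⟨π, hπ⟩ := MulAction.exists_smul_eq (Equiv.Perm D) e f
  have h : ∀ i, π (e i) = f i := fun i => by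
    have := DFunLike.congr_fun hπ i
    simpa using this
  exact ⟨π, h 0, h 1, h 2⟩

theorem swaps_same_image {D Q : Type*} [Finite D] [DecidableEq D] [Group Q] [Finite Q]
    (hcard : Nat.card Q + 2 ≤ Nat.card D) (F : Equiv.Perm D →* Q) {x y x' y' : D}
    (h : x ≠ y) (h' : x' ≠ y') : F (Equiv.swap x y) = F (Equiv.swap x' y') := by
  have hQ : 0 < Nat.card Q := Nat.card_pos
  have : Nonempty D := ⟨x⟩
  -- pigeonhole
  have hnot : ¬ Function.Injective (fun d : {d : D // d ≠ x} => F (Equiv.swap x d.1)) := by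
    intro hinj
    have h1 := Nat.card_le_card_of_injective _ hinj
    have h2 : Nat.card {d : D // d ≠ x} = Nat.card D - 1 := by
      have := Fintype.ofFinite D
      rw [Nat.card_eq_fintype_card, Nat.card_eq_fintype_card]
      simp [Fintype.card_subtype_compl]
    omega
  simp only [Function.Injective, not_forall] at hnot
  obtain ⟨⟨b, hb⟩, ⟨c, hc⟩, hF, hbc⟩ := hnot
  have hbc' : b ≠ c := fun h => hbc (Subtype.ext h)
  have key : ∀ u v w : D, u ≠ v → u ≠ w → F (Equiv.swap u v) = F (Equiv.swap u w) := by
    intro u v w huv huw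
    by_cases hvw : v = w
    · rw [hvw]
    obtain ⟨π, h1, h2, h3⟩ := exists_perm_three hb.symm hc.symm hbc' huv huw hvw
    have e1 : Equiv.swap u v = π * Equiv.swap x b * π⁻¹ := by
      rw [← h1, ← h2, Equiv.swap_apply_apply]
    have e2 : Equiv.swap u w = π * Equiv.swap x c * π⁻¹ := by
      rw [← h1, ← h3, Equiv.swap_apply_apply]
    rw [e1, e2]
    simp only [map_mul]
    rw [show F (Equiv.swap x b) = F (Equiv.swap x c) from hF]
  by_cases hxx : x = x'
  · subst hxx; exact key _ _ _ h h'
  · have hsw := key x' x y' (Ne.symm hxx) h'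
    rw [key x y x' h hxx, Equiv.swap_comm, hsw]

/-- The permutations preserving the fibres of `e`. -/
def fibPerm {P V : Type*} (e : P → V) : Subgroup (Equiv.Perm P) where
  carrier := {σ | ∀ p, e (σ p) = e p}
  one_mem' := fun _ => rfl
  mul_mem' := by
    intro a b ha hb p
    simp only [Set.mem_ofPred_eq] at ha hb
    rw [Equiv.Perm.mul_apply, ha, hb]
  inv_mem' := by
    intro a ha p
    simp only [Set.mem_ofPred_eq] at ha
    have := ha (a⁻¹ p)
    rw [show a (a⁻¹ p) = p from a.apply_symm_apply p] at this
    exact this.symm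

theorem swap_mem_fibPerm {P V : Type*} [DecidableEq P] (e : P → V) {p q : P} (h : e p = e q) :
    Equiv.swap p q ∈ fibPerm e := by
  intro r
  rw [Equiv.swap_apply_def]
  split_ifs with h1 h2
  · rw [h1, h]
  · rw [h2, h]
  · rfl

theorem fibPerm_induct {P V : Type*} [Finite P] [DecidableEq P] (e : P → V)
    (M : Subgroup (fibPerm e))
    (hM : ∀ p q (h : e p = e q), p ≠ q → (⟨Equiv.swap p q, swap_mem_fibPerm e h⟩ : fibPerm e) ∈ M)
    (σ : fibPerm e) : σ ∈ M := by
  let T : Set (Equiv.Perm P) := {t | ∃ p q, e p = e q ∧ p ≠ q ∧ t = Equiv.swap p q}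
  have hT : ∀ f ∈ T, f.IsSwap := by
    rintro f ⟨p, q, -, hpq, rfl⟩
    exact ⟨p, q, hpq, rfl⟩
  have h1 : σ.1 ∈ Subgroup.closure T := by
    rw [mem_closure_isSwap hT]
    refine ⟨Set.toFinite _, fun x => ?_⟩
    by_cases hx : x = σ.1 x
    · rw [← hx]; exact MulAction.mem_orbit_self x
    · exact ⟨⟨Equiv.swap x (σ.1 x), Subgroup.subset_closure ⟨x, σ.1 x, (σ.2 x).symm, hx, rfl⟩⟩,
        Equiv.swap_apply_left x (σ.1 x)⟩
  have h2 : Subgroup.closure T ≤ M.map (fibPerm e).subtype := by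
    rw [Subgroup.closure_le]
    rintro f ⟨p, q, h, hpq, rfl⟩
    exact ⟨_, hM p q h hpq, rfl⟩
  obtain ⟨τ, hτ, hτσ⟩ := h2 h1
  have : τ = σ := Subtype.ext hτσ
  rwa [← this]

theorem fibPerm_image {P V Q : Type*} [Finite P] (e : P → V) [Group Q] [Finite Q]
    (hcard : ∀ p, Nat.card Q + 2 ≤ Nat.card {q // e q = e p}) (F : fibPerm e →* Q) :
    (∀ σ τ, F σ * F τ = F τ * F σ) ∧ ∀ σ, F σ * F σ = 1 := by
  classical
  let sw : ∀ p q (h : e p = e q), fibPerm e := fun p q h =>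
    ⟨Equiv.swap p q, swap_mem_fibPerm e h⟩
  have hsame : ∀ p q p' q' (h : e p = e q) (h' : e p' = e q'), p ≠ q → p' ≠ q' → e p = e p' →
      F (sw p q h) = F (sw p' q' h') := by
    intro p q p' q' h h' hne hne' hh
    let D := {r // e r = e p}
    let J : Equiv.Perm D →* fibPerm e :=
      (Equiv.Perm.ofSubtype (p := fun r => e r = e p)).codRestrict _ (by
        intro σ r
        by_cases hr : e r = e p
        · rw [Equiv.Perm.ofSubtype_apply_of_mem σ hr, hr]
          exact (σ ⟨r, hr⟩).2
        · rw [Equiv.Perm.ofSubtype_apply_of_not_mem σ hr])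
    have hJ : ∀ (a b : D) (hab : e a.1 = e b.1), J (Equiv.swap a b) = sw a.1 b.1 hab := by
      intro a b hab
      apply Subtype.ext
      exact Equiv.Perm.ofSubtype_swap_eq a b
    have := swaps_same_image (hcard p) (F.comp J) (x := (⟨p, rfl⟩ : D)) (y := ⟨q, h.symm⟩)
      (x' := ⟨p', hh.symm⟩) (y' := ⟨q', h'.symm.trans hh.symm⟩)
      (fun h => hne (congrArg Subtype.val h)) (fun h => hne' (congrArg Subtype.val h))
    rw [MonoidHom.comp_apply, MonoidHom.comp_apply, hJ _ _ h, hJ _ _ h'] at this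
    exact this
  have hcs : ∀ p q p' q' (h : e p = e q) (h' : e p' = e q'), p ≠ q → p' ≠ q' →
      F (sw p q h) * F (sw p' q' h') = F (sw p' q' h') * F (sw p q h) := by
    intro p q p' q' h h' hne hne'
    by_cases hh : e p = e p'
    · rw [hsame p q p' q' h h' hne hne' hh]
    · rw [← map_mul, ← map_mul]
      congr 1
      apply Subtype.ext
      change Equiv.swap p q * Equiv.swap p' q' = Equiv.swap p' q' * Equiv.swap p q
      have hd : Equiv.Perm.Disjoint (Equiv.swap p q) (Equiv.swap p' q') := by
        intro r
        by_cases hr : e r = e p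
        · right
          apply Equiv.swap_apply_of_ne_of_ne
          · rintro rfl; exact hh hr.symm
          · rintro rfl; exact hh (hr.symm.trans h'.symm)
        · left
          apply Equiv.swap_apply_of_ne_of_ne
          · rintro rfl; exact hr rfl
          · rintro rfl; exact hr h.symm
      exact hd.commute
  have hcomm : ∀ σ τ, F σ * F τ = F τ * F σ := by
    have h1 : ∀ p q (h : e p = e q), p ≠ q → ∀ τ, F (sw p q h) * F τ = F τ * F (sw p q h) := by
      intro p q h hne τ
      have := fibPerm_induct e ((Subgroup.centralizer {F (sw p q h)}).comap F)
        (fun p' q' h' hne' => by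
          rw [Subgroup.mem_comap, Subgroup.mem_centralizer_singleton_iff]
          exact hcs _ _ _ _ h' h hne' hne) τ
      rw [Subgroup.mem_comap, Subgroup.mem_centralizer_singleton_iff] at this
      exact this.symm
    intro σ τ
    have := fibPerm_induct e ((Subgroup.centralizer {F τ}).comap F)
        (fun p' q' h' hne' => by
          rw [Subgroup.mem_comap, Subgroup.mem_centralizer_singleton_iff]
          exact h1 _ _ h' hne' τ) σ
    rw [Subgroup.mem_comap, Subgroup.mem_centralizer_singleton_iff] at this
    exact this
  refine ⟨hcomm, fun σ => ?_⟩
  let M : Subgroup (fibPerm e) :=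
    { carrier := {σ | F σ * F σ = 1}
      one_mem' := by simp
      mul_mem' := by
        intro a b ha hb
        simp only [Set.mem_ofPred_eq, map_mul] at *
        rw [mul_assoc, ← mul_assoc (F b), hcomm b a, mul_assoc (F a), hb, mul_one, ha]
      inv_mem' := by
        intro a ha
        simp only [Set.mem_ofPred_eq, map_inv] at *
        rw [← mul_inv_rev, ha, inv_one] }
  refine fibPerm_induct e M (fun p q h hne => ?_) σ
  change F _ * F _ = 1
  rw [← map_mul]
  convert map_one F
  apply Subtype.ext
  exact Equiv.swap_mul_self p q

theorem exists_flip_of_even {S : Type*} [Finite S] (h : Even (Nat.card S)) :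
    ∃ (ι : S → S) (b : S → Bool), (∀ s, ι (ι s) = s) ∧ ∀ s, b (ι s) = !b s := by
  obtain ⟨k, hk⟩ := h
  obtain ⟨e⟩ : Nonempty (S ≃ Fin k × Bool) := (Finite.card_eq).1 (by simp [hk, mul_two])
  refine ⟨fun s => e.symm ((e s).1, !(e s).2), fun s => (e s).2, fun s => ?_, fun s => ?_⟩ <;> simp

theorem exists_flip_fibre {S C : Type*} [Finite S] (f : S → C)
    (h : ∀ c, Even (Nat.card {s // f s = c})) :
    ∃ (ι : S → S) (b : S → Bool), (∀ s, ι (ι s) = s) ∧ (∀ s, b (ι s) = !b s) ∧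
      ∀ s, f (ι s) = f s := by
  choose ι b h1 h2 using fun c => exists_flip_of_even (h c)
  let I : S → S := fun s => (ι (f s) ⟨s, rfl⟩).1
  let bb : S → Bool := fun s => b (f s) ⟨s, rfl⟩
  have hI : ∀ c s (hs : f s = c), I s = (ι c ⟨s, hs⟩).1 := by rintro _ s rfl; rfl
  have hb : ∀ c s (hs : f s = c), bb s = b c ⟨s, hs⟩ := by rintro _ s rfl; rfl
  have hf : ∀ s, f (I s) = f s := fun s => (ι (f s) ⟨s, rfl⟩).2
  refine ⟨I, bb, fun s => ?_, fun s => ?_, hf⟩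
  · rw [hI (f s) (I s) (hf s)]
    change (ι (f s) (ι (f s) ⟨s, rfl⟩)).1 = s
    rw [h1]
  · rw [hb (f s) (I s) (hf s)]
    change b (f s) (ι (f s) ⟨s, rfl⟩) = _
    rw [h2]
namespace BratteliDiagram

/-- Two paths agree on the first `n` edges. -/
def Agree (B : BratteliDiagram) (n : ℕ) (x y : B.Path) : Prop := ∀ i, i < n → x.1 i = y.1 i

theorem Agree.symm {B : BratteliDiagram} {n : ℕ} {x y : B.Path} (h : B.Agree n x y) :
    B.Agree n y x := fun i hi => (h i hi).symm

theorem Agree.trans {B : BratteliDiagram} {n : ℕ} {x y z : B.Path} (h : B.Agree n x y)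
    (h' : B.Agree n y z) : B.Agree n x z := fun i hi => (h i hi).trans (h' i hi)

theorem Agree.mono {B : BratteliDiagram} {n m : ℕ} (hnm : n ≤ m) {x y : B.Path}
    (h : B.Agree m x y) : B.Agree n x y := fun i hi => h i (hi.trans_le hnm)

theorem Agree.src {B : BratteliDiagram} {n : ℕ} {x y : B.Path} (h : B.Agree n x y) :
    B.src n (x.1 n) = B.src n (y.1 n) := by
  cases n with
  | zero => have := B.subsingleton_root; exact Subsingleton.elim _ _
  | succ k => rw [← x.2 k, ← y.2 k, h k (Nat.lt_succ_self k)]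

theorem path_ext {B : BratteliDiagram} {x y : B.Path} (n : ℕ) (h : B.Agree n x y)
    (h' : ∀ i, n ≤ i → x.1 i = y.1 i) : x = y := by
  apply Subtype.ext
  funext i
  rcases lt_or_ge i n with hi | hi
  · exact h i hi
  · exact h' i hi

/-- The path with the first `n` edges of `x`, continued along `z`. -/
def glue (B : BratteliDiagram) (n : ℕ) (x z : B.Path) (h : B.src n (x.1 n) = B.src n (z.1 n)) :
    B.Path :=
  ⟨fun i => if i < n then x.1 i else z.1 i, by
    intro i
    dsimp only
    rcases lt_trichotomy (i + 1) n with hi | hi | hi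
    · rw [if_pos (by omega), if_pos hi]; exact x.2 i
    · subst hi
      rw [if_pos (by omega), if_neg (by omega), x.2 i, h]
    · rw [if_neg (by omega), if_neg (by omega)]; exact z.2 i⟩

theorem glue_agree {B : BratteliDiagram} {n : ℕ} {x z : B.Path}
    (h : B.src n (x.1 n) = B.src n (z.1 n)) : B.Agree n (B.glue n x z h) x :=
  fun _ hi => if_pos hi

theorem glue_tail {B : BratteliDiagram} {n : ℕ} {x z : B.Path}
    (h : B.src n (x.1 n) = B.src n (z.1 n)) (i : ℕ) (hi : n ≤ i) :
    (B.glue n x z h).1 i = z.1 i := if_neg (by omega)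

/-- The segment of a path. -/
def seg (B : BratteliDiagram) (n L : ℕ) (x : B.Path) : B.Seg n L :=
  ⟨fun i => x.1 (n + i), fun i _ => x.2 (n + i)⟩

theorem splice (B : BratteliDiagram) (n L : ℕ) (s : B.Seg n L) (x z : B.Path)
    (hx : B.src n (s.1 ⟨0, by omega⟩) = B.src n (x.1 n))
    (hz : B.rng (n + L) (s.1 ⟨L, by omega⟩) = B.src (n + L + 1) (z.1 (n + L + 1))) :
    ∃ y : B.Path, B.Agree n y x ∧ B.seg n L y = s ∧ ∀ i, n + L + 1 ≤ i → y.1 i = z.1 i := by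
  classical
  let F : ∀ i, B.E i := fun i => if h : ∃ j : Fin (L + 1), n + (j : ℕ) = i then
    h.choose_spec ▸ s.1 h.choose else z.1 i
  have hF : ∀ j (hj : j < L + 1), F (n + j) = s.1 ⟨j, hj⟩ := by
    intro j hj
    have hex : ∃ j' : Fin (L + 1), n + (j' : ℕ) = n + j := ⟨⟨j, hj⟩, rfl⟩
    have : ∀ (k : Fin (L + 1)) (hk : n + (k : ℕ) = n + j), (hk ▸ s.1 k : B.E (n + j)) = s.1 ⟨j, hj⟩ := by
      rintro ⟨k, hk'⟩ hk
      have : k = j := by simpa using hk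
      subst this
      rfl
    simp only [F]
    rw [dif_pos hex]
    exact this _ _
  have hFz : ∀ i, n + L + 1 ≤ i → F i = z.1 i := by
    intro i hi
    simp only [F]
    rw [dif_neg]
    rintro ⟨⟨j, hj⟩, h⟩
    simp only at h
    omega
  have hpath : ∀ i, n ≤ i → B.rng i (F i) = B.src (i + 1) (F (i + 1)) := by
    intro i hi
    obtain ⟨j, rfl⟩ := Nat.exists_eq_add_of_le hi
    rcases lt_trichotomy j L with h | h | h
    · rw [hF j (by omega), show F (n + j + 1) = _ from hF (j + 1) (by omega)]
      exact s.2 j h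
    · subst h
      rw [hF j (by omega), hFz _ (by omega), hz]
    · rw [hFz _ (by omega), hFz _ (by omega)]
      exact z.2 _
  let Y : ∀ i, B.E i := fun i => if i < n then x.1 i else F i
  have hY : ∀ i, n ≤ i → Y i = F i := fun i hi => if_neg (by omega)
  refine ⟨⟨Y, ?_⟩, fun i hi => if_pos hi, ?_, ?_⟩
  · intro i
    rcases lt_trichotomy (i + 1) n with hi | hi | hi
    · simp only [Y]
      rw [if_pos (by omega), if_pos hi]; exact x.2 i
    · subst hi
      simp only [Y]
      rw [if_pos (by omega), if_neg (by omega), x.2 i, ← hx]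
      exact congrArg _ (hF 0 (by omega)).symm
    · rw [hY _ (by omega), hY _ (by omega)]
      exact hpath i (by omega)
  · apply Subtype.ext
    funext j
    change Y (n + j) = _
    rw [hY _ (by omega), hF j j.2]
  · intro i hi
    change Y i = _
    rw [hY _ (by omega), hFz i hi]

theorem seg_apply_eq {B : BratteliDiagram} {n L : ℕ} {x y : B.Path}
    (h : B.seg n L x = B.seg n L y) (i : ℕ) (h1 : n ≤ i) (h2 : i < n + L + 1) : x.1 i = y.1 i := by
  obtain ⟨j, rfl⟩ := Nat.exists_eq_add_of_le h1
  exact congrFun (congrArg Subtype.val h) ⟨j, by omega⟩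

theorem seg_congr {B : BratteliDiagram} {n L : ℕ} {x y : B.Path}
    (h : ∀ i, n ≤ i → i < n + L + 1 → x.1 i = y.1 i) : B.seg n L x = B.seg n L y := by
  apply Subtype.ext
  funext j
  exact h _ (by omega) (by omega)

instance (B : BratteliDiagram) (n L : ℕ) : Finite (B.Seg n L) := by
  have := fun i => B.fintypeE i
  unfold Seg
  infer_instance

theorem path_ext₃ {B : BratteliDiagram} {x y : B.Path} (n L : ℕ) (h : B.Agree n x y)
    (hs : B.seg n L x = B.seg n L y)
    (h' : ∀ i, n + L + 1 ≤ i → x.1 i = y.1 i) : x = y := by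
  refine path_ext n h fun i hi => ?_
  rcases lt_or_ge i (n + L + 1) with hi' | hi'
  · exact seg_apply_eq hs i hi hi'
  · exact h' i hi'

/-- `A` is determined by the first `n` edges. -/
def Sat (B : BratteliDiagram) (n : ℕ) (A : Set B.Path) : Prop :=
  ∀ x y, B.Agree n x y → (x ∈ A ↔ y ∈ A)

theorem Sat.mono {B : BratteliDiagram} {n m : ℕ} (hnm : n ≤ m) {A : Set B.Path}
    (h : B.Sat n A) : B.Sat m A := fun x y hxy => h x y (hxy.mono hnm)

instance (B : BratteliDiagram) (i : ℕ) : DiscreteTopology (B.E i) := ⟨rfl⟩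

theorem continuous_coord (B : BratteliDiagram) (i : ℕ) : Continuous fun x : B.Path => x.1 i :=
  (continuous_apply i).comp continuous_subtype_val

instance (B : BratteliDiagram) : CompactSpace B.Path := by
  have := fun i => B.fintypeE i
  have hc : IsClosed {x : ∀ i, B.E i | ∀ i, B.rng i (x i) = B.src (i + 1) (x (i + 1))} := by
    have : {x : ∀ i, B.E i | ∀ i, B.rng i (x i) = B.src (i + 1) (x (i + 1))} =
        ⋂ i, {x : ∀ i, B.E i | B.rng i (x i) = B.src (i + 1) (x (i + 1))} := by
      ext; simp
    rw [this]
    refine isClosed_iInter fun i => ?_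
    have hcont : Continuous fun x : ∀ i, B.E i => (x i, x (i + 1)) := by fun_prop
    exact (isClosed_discrete {p : B.E i × B.E (i + 1) | B.rng i p.1 = B.src (i + 1) p.2}).preimage
      hcont
  exact isCompact_iff_compactSpace.1 hc.isCompact

theorem exists_sat (B : BratteliDiagram) (A : Set B.Path) (hA : IsClopen A) : ∃ n, B.Sat n A := by
  by_contra hcon
  simp only [not_exists] at hcon
  let D : ℕ → Set (B.Path × B.Path) := fun n => {p | B.Agree n p.1 p.2 ∧ p.1 ∈ A ∧ p.2 ∈ Aᶜ}
  have hag : ∀ n, IsClosed {p : B.Path × B.Path | B.Agree n p.1 p.2} := by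
    intro n
    have : {p : B.Path × B.Path | B.Agree n p.1 p.2} =
        ⋂ i, ⋂ (_ : i < n), {p : B.Path × B.Path | p.1.1 i = p.2.1 i} := by
      ext; simp [Agree]
    rw [this]
    refine isClosed_iInter fun i => isClosed_iInter fun _ => ?_
    exact isClosed_eq ((B.continuous_coord i).comp continuous_fst)
      ((B.continuous_coord i).comp continuous_snd)
  have hcl : ∀ n, IsClosed (D n) := fun n =>
    (hag n).inter ((hA.1.preimage continuous_fst).inter (hA.compl.1.preimage continuous_snd))
  have hne : ∀ n, (D n).Nonempty := by
    intro n
    have := hcon n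
    simp only [Sat, not_forall] at this
    obtain ⟨x, y, hxy, h⟩ := this
    by_cases hx : x ∈ A
    · exact ⟨(x, y), hxy, hx, fun hy => h (by simp [hx, hy])⟩
    · by_cases hy : y ∈ A
      · exact ⟨(y, x), hxy.symm, hy, hx⟩
      · exact absurd (by simp [hx, hy]) h
  obtain ⟨⟨x, y⟩, hp⟩ := IsCompact.nonempty_iInter_of_sequence_nonempty_isCompact_isClosed D
    (fun n p hp => ⟨hp.1.mono (Nat.le_succ n), hp.2⟩) hne (hcl 0).isCompact hcl
  rw [Set.mem_iInter] at hp
  have hxy : x = y := Subtype.ext (funext fun i => (hp (i + 1)).1 i (Nat.lt_succ_self i))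
  have h0 := (hp 0).2
  simp only [hxy] at h0
  exact h0.2 h0.1

theorem finite_level (B : BratteliDiagram) (n : ℕ) : Finite (B.level n) := by
  have := fun i => B.fintypeE i
  let pre : B.Path → (∀ i : Fin n, B.E i) := fun x i => x.1 i
  have hpre : ∀ x y, pre x = pre y ↔ B.Agree n x y := fun x y =>
    ⟨fun h i hi => congrFun h ⟨i, hi⟩, fun h => funext fun i => h i i.2⟩
  let Φ : B.level n → Set ((∀ i : Fin n, B.E i) × (∀ i : Fin n, B.E i)) := fun g =>
    {q | ∃ x, q = (pre x, pre (g.1 x))}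
  refine Finite.of_injective Φ ?_
  intro g h hgh
  apply Subtype.ext
  ext x
  have : (pre x, pre (g.1 x)) ∈ Φ h := by rw [← hgh]; exact ⟨x, rfl⟩
  obtain ⟨y, hy⟩ := this
  rw [Prod.mk.injEq] at hy
  have h1 := (hpre _ _).1 hy.1
  have h2 := (hpre _ _).1 hy.2
  exact path_ext n (h2.trans (Agree.symm (h.2.1.2 x y h1)))
    (fun i hi => (g.2.1.1 x i hi).trans (h.2.1.1 x i hi).symm)

theorem finite_levelIn (B : BratteliDiagram) (n : ℕ) : Finite (B.levelIn n) := by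
  have := B.finite_level n
  refine Finite.of_injective (fun g : B.levelIn n => (⟨g.1.1, g.2⟩ : B.level n)) ?_
  intro a b h
  apply Subtype.ext
  apply Subtype.ext
  exact congrArg (fun z : B.level n => z.1) h

instance (B : BratteliDiagram) : Countable B.fullGroup := by
  have : (Set.univ : Set B.fullGroup) = ⋃ n, (B.levelIn n : Set B.fullGroup) := by
    ext g
    simp only [Set.mem_univ, Set.mem_iUnion, true_iff]
    exact g.2
  rw [← Set.countable_univ_iff, this]
  refine Set.countable_iUnion fun n => ?_
  have := B.finite_levelIn n
  exact (Set.toFinite _).countable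

theorem mem_Gcirc {B : BratteliDiagram} {A : Set B.Path} {g : B.fullGroup} :
    g ∈ B.Gcirc A ↔ ∀ x ∈ A, g.1 x = x := by
  simp only [Gcirc, Subgroup.mem_iInf, MulAction.mem_stabilizer_iff]
  rfl

/-- Every realized vertex of level `n` has many prefixes outside `A`. -/
def Big (B : BratteliDiagram) (A : Set B.Path) (ι : Type) (n : ℕ) : Prop :=
  ∀ z : B.Path, ∃ x : ι → B.Path, (∀ i, x i ∉ A) ∧ (∀ i, B.src n ((x i).1 n) = B.src n (z.1 n)) ∧
    ∀ i j, B.Agree n (x i) (x j) → i = j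

theorem src_of_tail {B : BratteliDiagram} {n m : ℕ} (hnm : n ≤ m) {x y : B.Path}
    (h : ∀ i, n ≤ i → x.1 i = y.1 i) : B.src m (x.1 m) = B.src m (y.1 m) := by
  rw [h m hnm]

theorem Big.mono {B : BratteliDiagram} {A : Set B.Path} {ι : Type} {n m : ℕ} (hnm : n ≤ m)
    (hA : B.Sat n A) (h : B.Big A ι n) : B.Big A ι m := by
  intro z
  obtain ⟨x, h1, h2, h3⟩ := h z
  refine ⟨fun i => B.glue n (x i) z (h2 i), fun i => ?_, fun i => ?_, fun i j hij => ?_⟩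
  · rw [hA _ _ (glue_agree (h2 i))]; exact h1 i
  · exact src_of_tail hnm (fun k hk => glue_tail (h2 i) k hk)
  · apply h3
    exact ((glue_agree (h2 i)).symm.trans (hij.mono hnm)).trans (glue_agree (h2 j))

theorem Big.step {B : BratteliDiagram} (heven : B.IsEven) {A : Set B.Path} {ι : Type} {n : ℕ}
    (hA : B.Sat n A) (h : B.Big A ι n) : ∃ m, n ≤ m ∧ B.Big A (ι × Bool) m := by
  obtain ⟨L, hL⟩ := heven n
  refine ⟨n + L + 1, by omega, fun z => ?_⟩
  obtain ⟨x, h1, h2, h3⟩ := h z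
  obtain ⟨hp, hev⟩ := hL (B.src n (z.1 n)) (B.src (n + L + 1) (z.1 (n + L + 1)))
  have h2' : 1 < B.numPaths n L (B.src n (z.1 n)) (B.src (n + L + 1) (z.1 (n + L + 1))) := by
    obtain ⟨k, hk⟩ := hev
    omega
  unfold numPaths at h2'
  have hnt := Finite.one_lt_card_iff_nontrivial.1 h2'
  obtain ⟨s, s', hss⟩ := hnt
  let t : Bool → B.Seg n L := fun b => if b then s.1 else s'.1
  have ht : ∀ b, B.src n ((t b).1 ⟨0, by omega⟩) = B.src n (z.1 n) ∧
      B.rng (n + L) ((t b).1 ⟨L, by omega⟩) = B.src (n + L + 1) (z.1 (n + L + 1)) := by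
    intro b
    cases b
    · exact s'.2
    · exact s.2
  have htinj : ∀ b c, t b = t c → b = c := by
    intro b c h
    cases b <;> cases c <;> simp only [t, Bool.false_eq_true, if_true, if_false] at h ⊢
    · exact (hss (Subtype.ext h.symm)).elim
    · exact (hss (Subtype.ext h)).elim
  choose y hy1 hy2 hy3 using fun p : ι × Bool =>
    B.splice n L (t p.2) (x p.1) z ((ht p.2).1.trans (h2 p.1).symm) (ht p.2).2
  refine ⟨y, fun p => ?_, fun p => ?_, fun p q hpq => ?_⟩
  · rw [hA _ _ (hy1 p)]; exact h1 _
  · rw [hy3 p _ le_rfl]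
  · refine Prod.ext (h3 _ _ ?_) (htinj _ _ ?_)
    · exact ((hy1 p).symm.trans (hpq.mono (by omega))).trans (hy1 q)
    · rw [← hy2 p, ← hy2 q]
      exact seg_congr fun i _ hi => hpq i hi

theorem exists_big (B : BratteliDiagram) (heven : B.IsEven) {A : Set B.Path}
    (hne : A ≠ Set.univ) {n₀ : ℕ} (hA : B.Sat n₀ A) (r : ℕ) :
    ∃ (ι : Type) (n : ℕ), Finite ι ∧ r ≤ Nat.card ι ∧ n₀ ≤ n ∧ B.Big A ι n := by
  obtain ⟨x₀, hx₀⟩ := (Set.ne_univ_iff_exists_notMem A).1 hne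
  have key : ∃ (ι : Type) (n : ℕ), Finite ι ∧ r + 1 ≤ Nat.card ι ∧ n₀ ≤ n ∧ B.Big A ι n := by
    induction r with
    | zero =>
      obtain ⟨L, hL⟩ := heven n₀
      refine ⟨Unit, n₀ + L + 1, inferInstance, by simp, by omega, fun z => ?_⟩
      have hp := (hL (B.src n₀ (x₀.1 n₀)) (B.src (n₀ + L + 1) (z.1 (n₀ + L + 1)))).1
      unfold numPaths at hp
      obtain ⟨⟨s, hs1, hs2⟩⟩ := (Nat.card_pos_iff.1 hp).1
      obtain ⟨y, hy1, -, hy3⟩ := B.splice n₀ L s x₀ z hs1 hs2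
      refine ⟨fun _ => y, fun _ => ?_, fun _ => ?_, fun _ _ _ => rfl⟩
      · rw [hA _ _ hy1]; exact hx₀
      · rw [hy3 _ le_rfl]
    | succ k ih =>
      obtain ⟨ι, n, hf, hc, hn, hb⟩ := ih
      obtain ⟨m, hnm, hb'⟩ := hb.step heven (hA.mono hn)
      refine ⟨ι × Bool, m, inferInstance, ?_, hn.trans hnm, hb'⟩
      rw [Nat.card_prod]
      simp only [Nat.card_eq_fintype_card, Fintype.card_bool]
      omega
  obtain ⟨ι, n, h1, h2, h3⟩ := key
  exact ⟨ι, n, h1, by omega, h3⟩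

end BratteliDiagram
namespace BratteliDiagram

/-- Agreement on the first `m` edges, on the complement of `A`. -/
def preSetoid (B : BratteliDiagram) (m : ℕ) (A : Set B.Path) : Setoid {x : B.Path // x ∉ A} where
  r x y := B.Agree m x.1 y.1
  iseqv := ⟨fun _ _ _ => rfl, fun h => h.symm, fun h₁ h₂ => h₁.trans h₂⟩

/-- Prefixes of length `m` of paths outside `A`. -/
def Pre (B : BratteliDiagram) (m : ℕ) (A : Set B.Path) : Type := Quotient (B.preSetoid m A)

/-- The prefix of a path. -/
def pr (B : BratteliDiagram) (m : ℕ) (A : Set B.Path) (x : B.Path) (hx : x ∉ A) : B.Pre m A :=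
  Quotient.mk (B.preSetoid m A) ⟨x, hx⟩

/-- A path with a given prefix. -/
def rep {B : BratteliDiagram} {m : ℕ} {A : Set B.Path} (p : B.Pre m A) : B.Path :=
  (Quotient.out p).1

theorem rep_notMem {B : BratteliDiagram} {m : ℕ} {A : Set B.Path} (p : B.Pre m A) : rep p ∉ A :=
  (Quotient.out p).2

theorem pr_rep {B : BratteliDiagram} {m : ℕ} {A : Set B.Path} (p : B.Pre m A) :
    B.pr m A (rep p) (rep_notMem p) = p := Quotient.out_eq p

theorem pr_eq_iff {B : BratteliDiagram} {m : ℕ} {A : Set B.Path} {x y : B.Path} {hx : x ∉ A}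
    {hy : y ∉ A} : B.pr m A x hx = B.pr m A y hy ↔ B.Agree m x y :=
  Quotient.eq (r := B.preSetoid m A)

theorem rep_pr {B : BratteliDiagram} {m : ℕ} {A : Set B.Path} (x : B.Path) (hx : x ∉ A) :
    B.Agree m (rep (B.pr m A x hx)) x :=
  pr_eq_iff.1 (pr_rep (B.pr m A x hx))

instance (B : BratteliDiagram) (m : ℕ) (A : Set B.Path) : Finite (B.Pre m A) := by
  have := fun i => B.fintypeE i
  refine Finite.of_injective (fun p : B.Pre m A => fun i : Fin m => (rep p).1 i) ?_
  intro p q h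
  rw [← pr_rep p, ← pr_rep q, pr_eq_iff]
  exact fun i hi => congrFun h ⟨i, hi⟩

/-- The end vertex of a prefix. -/
def endv {B : BratteliDiagram} {m : ℕ} {A : Set B.Path} (p : B.Pre m A) : B.V m :=
  B.src m ((rep p).1 m)

theorem endv_pr {B : BratteliDiagram} {m : ℕ} {A : Set B.Path} (x : B.Path) (hx : x ∉ A) :
    endv (B.pr m A x hx) = B.src m (x.1 m) := (rep_pr x hx).src

open Classical in
/-- The action of a permutation of prefixes on paths. -/
def actP {B : BratteliDiagram} {m : ℕ} {A : Set B.Path}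
    (σ : fibPerm (endv : B.Pre m A → B.V m)) (x : B.Path) : B.Path :=
  if hx : x ∈ A then x else
    B.glue m (rep (σ.1 (B.pr m A x hx))) x ((σ.2 (B.pr m A x hx)).trans (endv_pr x hx))

theorem actP_mem {B : BratteliDiagram} {m : ℕ} {A : Set B.Path}
    (σ : fibPerm (endv : B.Pre m A → B.V m)) (x : B.Path) (hx : x ∈ A) : actP σ x = x :=
  dif_pos hx

theorem actP_tail {B : BratteliDiagram} {m : ℕ} {A : Set B.Path}
    (σ : fibPerm (endv : B.Pre m A → B.V m)) (x : B.Path) (i : ℕ) (hi : m ≤ i) :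
    (actP σ x).1 i = x.1 i := by
  by_cases hx : x ∈ A
  · rw [actP_mem σ x hx]
  · unfold actP
    rw [dif_neg hx]
    exact glue_tail _ i hi

theorem actP_agree {B : BratteliDiagram} {m : ℕ} {A : Set B.Path}
    (σ : fibPerm (endv : B.Pre m A → B.V m)) (x : B.Path) (hx : x ∉ A) :
    B.Agree m (actP σ x) (rep (σ.1 (B.pr m A x hx))) := by
  unfold actP
  rw [dif_neg hx]
  exact glue_agree _

theorem actP_notMem {B : BratteliDiagram} {m : ℕ} {A : Set B.Path} (hA : B.Sat m A)
    (σ : fibPerm (endv : B.Pre m A → B.V m)) (x : B.Path) (hx : x ∉ A) : actP σ x ∉ A := by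
  rw [hA _ _ (actP_agree σ x hx)]
  exact rep_notMem _

theorem pr_actP {B : BratteliDiagram} {m : ℕ} {A : Set B.Path} (hA : B.Sat m A)
    (σ : fibPerm (endv : B.Pre m A → B.V m)) (x : B.Path) (hx : x ∉ A) :
    B.pr m A (actP σ x) (actP_notMem hA σ x hx) = σ.1 (B.pr m A x hx) := by
  rw [← pr_rep (σ.1 (B.pr m A x hx)), pr_eq_iff]
  exact actP_agree σ x hx

/-- The homomorphism to permutations of the path space. -/
def permHom {B : BratteliDiagram} {m : ℕ} {A : Set B.Path} (hA : B.Sat m A) :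
    fibPerm (endv : B.Pre m A → B.V m) →* Equiv.Perm B.Path :=
  MonoidHom.toHomPerm
    { toFun := fun σ => (actP σ : B.Path → B.Path)
      map_one' := by
        funext x
        change actP 1 x = x
        by_cases hx : x ∈ A
        · exact actP_mem _ x hx
        · refine path_ext m ?_ (fun i hi => actP_tail _ x i hi)
          exact (actP_agree 1 x hx).trans (rep_pr x hx)
      map_mul' := by
        intro σ τ
        funext x
        change actP (σ * τ) x = actP σ (actP τ x)
        by_cases hx : x ∈ A
        · rw [actP_mem _ x hx, actP_mem _ x hx, actP_mem _ x hx]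
        · refine path_ext m ?_ (fun i hi => ?_)
          · have h1 := actP_agree (σ * τ) x hx
            have h2 := actP_agree σ (actP τ x) (actP_notMem hA τ x hx)
            rw [pr_actP hA τ x hx] at h2
            exact h1.trans h2.symm
          · rw [actP_tail _ _ i hi, actP_tail _ _ i hi, actP_tail _ _ i hi] }

theorem permHom_apply {B : BratteliDiagram} {m : ℕ} {A : Set B.Path} (hA : B.Sat m A)
    (σ : fibPerm (endv : B.Pre m A → B.V m)) (x : B.Path) : permHom hA σ x = actP σ x := rfl

theorem isLevel_permHom {B : BratteliDiagram} {m : ℕ} {A : Set B.Path} (hA : B.Sat m A)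
    (σ : fibPerm (endv : B.Pre m A → B.V m)) : B.IsLevel m (permHom hA σ) := by
  refine ⟨fun x i hi => actP_tail σ x i hi, fun x y hxy => ?_⟩
  change B.Agree m (actP σ x) (actP σ y)
  have hxy' : B.Agree m x y := hxy
  by_cases hx : x ∈ A
  · rw [actP_mem _ x hx, actP_mem _ y ((hA _ _ hxy').1 hx)]; exact hxy'
  · have hy : y ∉ A := fun h => hx ((hA _ _ hxy').2 h)
    have h1 := actP_agree σ x hx
    have h2 := actP_agree σ y hy
    rw [(pr_eq_iff (hx := hx) (hy := hy)).2 hxy'] at h1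
    exact h1.trans h2.symm

/-- The homomorphism to `G°(A)`. -/
def circHom {B : BratteliDiagram} {m : ℕ} {A : Set B.Path} (hA : B.Sat m A) :
    fibPerm (endv : B.Pre m A → B.V m) →* B.Gcirc A :=
  ((permHom hA).codRestrict B.fullGroup (fun σ =>
    show ∃ k, permHom hA σ ∈ B.level k from ⟨m, isLevel_permHom hA σ, by
      rw [← map_inv]; exact isLevel_permHom hA _⟩)).codRestrict (B.Gcirc A) (fun σ =>
      mem_Gcirc.2 fun x hx => actP_mem σ x hx)

theorem notMem_of_fix {B : BratteliDiagram} {A : Set B.Path} (a : Equiv.Perm B.Path)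
    (ha : ∀ x ∈ A, a x = x) (x : B.Path) (hx : x ∉ A) : a x ∉ A := by
  intro h
  have := ha _ h
  exact hx (by rwa [a.injective this] at h)

theorem circHom_surj {B : BratteliDiagram} {m : ℕ} {A : Set B.Path} (hA : B.Sat m A)
    (a : B.Gcirc A) (ha : a.1.1 ∈ B.level m) : ∃ σ, circHom hA σ = a := by
  have hfix : ∀ x ∈ A, a.1.1 x = x := mem_Gcirc.1 a.2
  have hfix' : ∀ x ∈ A, a.1.1⁻¹ x = x := mem_Gcirc.1 (inv_mem a.2)
  have hlev : ∀ x y, B.Agree m x y → B.Agree m (a.1.1 x) (a.1.1 y) := ha.1.2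
  have hlev' : ∀ x y, B.Agree m x y → B.Agree m (a.1.1⁻¹ x) (a.1.1⁻¹ y) := ha.2.2
  let σ : Equiv.Perm (B.Pre m A) :=
    { toFun := fun p => B.pr m A (a.1.1 (rep p)) (notMem_of_fix _ hfix _ (rep_notMem p))
      invFun := fun p => B.pr m A (a.1.1⁻¹ (rep p)) (notMem_of_fix _ hfix' _ (rep_notMem p))
      left_inv := by
        intro p
        conv_rhs => rw [← pr_rep p]
        rw [pr_eq_iff]
        refine (hlev' _ _ (rep_pr _ _)).trans ?_
        rw [show a.1.1⁻¹ (a.1.1 (rep p)) = rep p from a.1.1.symm_apply_apply _]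
        exact fun _ _ => rfl
      right_inv := by
        intro p
        conv_rhs => rw [← pr_rep p]
        rw [pr_eq_iff]
        refine (hlev _ _ (rep_pr _ _)).trans ?_
        rw [show a.1.1 (a.1.1⁻¹ (rep p)) = rep p from a.1.1.apply_symm_apply _]
        exact fun _ _ => rfl }
  have hσ : σ ∈ fibPerm (endv : B.Pre m A → B.V m) := by
    intro p
    change endv (B.pr m A (a.1.1 (rep p)) _) = _
    rw [endv_pr, ha.1.1 _ m le_rfl]
    rfl
  refine ⟨⟨σ, hσ⟩, ?_⟩
  apply Subtype.ext
  apply Subtype.ext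
  ext x
  change actP ⟨σ, hσ⟩ x = a.1.1 x
  by_cases hx : x ∈ A
  · rw [actP_mem _ x hx, hfix x hx]
  · refine path_ext m ?_ (fun i hi => ?_)
    · refine (actP_agree ⟨σ, hσ⟩ x hx).trans ?_
      refine (rep_pr _ (notMem_of_fix _ hfix _ (rep_notMem _))).trans ?_
      exact hlev _ _ (rep_pr x hx)
    · rw [actP_tail _ x i hi, ha.1.1 x i hi]

theorem image_comm {B : BratteliDiagram} {m : ℕ} {A : Set B.Path} (hA : B.Sat m A)
    {ι : Type} {Q : Type*} [Finite ι] [Group Q] [Finite Q] (hι : Nat.card Q + 2 ≤ Nat.card ι)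
    (hbig : B.Big A ι m) (f : B.Gcirc A →* Q) (a h : B.Gcirc A) (ha : a.1.1 ∈ B.level m)
    (hh : h.1.1 ∈ B.level m) : f a * f h = f h * f a ∧ f a * f a = 1 := by
  obtain ⟨σ, rfl⟩ := circHom_surj hA a ha
  obtain ⟨τ, rfl⟩ := circHom_surj hA h hh
  have key := fibPerm_image (endv : B.Pre m A → B.V m) (Q := Q) (fun p => ?_) (f.comp (circHom hA))
  · exact ⟨key.1 σ τ, key.2 σ⟩
  · obtain ⟨x, h1, h2, h3⟩ := hbig (rep p)
    refine hι.trans (Nat.card_le_card_of_injective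
      (fun i => (⟨B.pr m A (x i) (h1 i), (endv_pr _ _).trans (h2 i)⟩ :
        {q : B.Pre m A // endv q = endv p})) ?_)
    intro i j hij
    exact h3 i j (pr_eq_iff.1 (congrArg Subtype.val hij))

theorem exists_decomp {B : BratteliDiagram} (heven : B.IsEven) {n : ℕ} {A : Set B.Path}
    (hA : B.Sat n A) (g : B.Gcirc A) (hg : g.1.1 ∈ B.level n) :
    ∃ m, n ≤ m ∧ ∃ a h : B.Gcirc A, a.1.1 ∈ B.level m ∧ h.1.1 ∈ B.level m ∧
      g = a * (h * a * h) ∧ h * h = 1 := by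
  classical
  obtain ⟨L, hL⟩ := heven n
  obtain ⟨ι, b, hιι, hbι, hfι⟩ := exists_flip_fibre
    (fun s : B.Seg n L => (B.src n (s.1 ⟨0, by omega⟩), B.rng (n + L) (s.1 ⟨L, by omega⟩)))
    (by
      rintro ⟨v, w⟩
      have := (hL v w).2
      unfold numPaths at this
      simpa only [Prod.mk.injEq] using this)
  have hfix : ∀ x ∈ A, g.1.1 x = x := mem_Gcirc.1 g.2
  have hfix' : ∀ x ∈ A, g.1.1⁻¹ x = x := mem_Gcirc.1 (inv_mem g.2)
  have hlev : ∀ x y, B.Agree n x y → B.Agree n (g.1.1 x) (g.1.1 y) := hg.1.2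
  -- the flip
  have hsp : ∀ x : B.Path, ∃ y : B.Path, B.Agree n y x ∧ B.seg n L y = ι (B.seg n L x) ∧
      ∀ i, n + L + 1 ≤ i → y.1 i = x.1 i := by
    intro x
    have := hfι (B.seg n L x)
    rw [Prod.mk.injEq] at this
    exact B.splice n L _ x x this.1 (this.2.trans (x.2 (n + L)))
  choose Y hY1 hY2 hY3 using hsp
  let hf : B.Path → B.Path := fun x => if x ∈ A then x else Y x
  have hfA : ∀ x ∈ A, hf x = x := fun x hx => if_pos hx
  have hfN : ∀ x, x ∉ A → hf x = Y x := fun x hx => if_neg hx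
  have hYN : ∀ x, x ∉ A → Y x ∉ A := fun x hx h => hx ((hA _ _ (hY1 x)).1 h)
  have hinv : Function.Involutive hf := by
    intro x
    by_cases hx : x ∈ A
    · rw [hfA x hx, hfA x hx]
    · rw [hfN x hx, hfN _ (hYN x hx)]
      refine path_ext₃ n L ((hY1 _).trans (hY1 _)) ?_ (fun i hi => ?_)
      · rw [hY2, hY2, hιι]
      · rw [hY3 _ i hi, hY3 _ i hi]
  let hp : Equiv.Perm B.Path := hinv.toPerm
  have hhl : B.IsLevel (n + L + 1) hp := by
    constructor
    · intro x i hi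
      change (hf x).1 i = _
      by_cases hx : x ∈ A
      · rw [hfA x hx]
      · rw [hfN x hx, hY3 x i hi]
    · intro x y hxy
      change B.Agree (n + L + 1) (hf x) (hf y)
      have hxy' : B.Agree (n + L + 1) x y := hxy
      have hxyn : B.Agree n x y := hxy'.mono (by omega)
      by_cases hx : x ∈ A
      · rw [hfA x hx, hfA y ((hA _ _ hxyn).1 hx)]; exact hxy'
      · rw [hfN x hx, hfN y (fun h => hx ((hA _ _ hxyn).2 h))]
        have hseg : B.seg n L (Y x) = B.seg n L (Y y) := by
          rw [hY2, hY2, seg_congr (x := x) (y := y) (fun i _ hi => hxy' i hi)]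
        intro i hi
        rcases lt_or_ge i n with h | h
        · exact (((hY1 x).trans hxyn).trans (hY1 y).symm) i h
        · exact seg_apply_eq hseg i h hi
  have hhinv : hp⁻¹ = hp := rfl
  have hpl : hp ∈ B.level (n + L + 1) := ⟨hhl, by rw [hhinv]; exact hhl⟩
  -- the half of `g`
  have hseg : ∀ k : Equiv.Perm B.Path, B.IsLevel n k → ∀ x, B.seg n L (k x) = B.seg n L x :=
    fun k hk x => seg_congr fun i hi _ => hk.1 x i hi
  let af : Equiv.Perm B.Path → B.Path → B.Path := fun k x =>
    if b (B.seg n L x) = true then k x else x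
  have hafl : ∀ k, B.IsLevel n k → (∀ x i, n + L + 1 ≤ i → (af k x).1 i = x.1 i) ∧
      ∀ x y, B.Agree (n + L + 1) x y → B.Agree (n + L + 1) (af k x) (af k y) := by
    intro k hk
    constructor
    · intro x i hi
      simp only [af]
      split_ifs
      · exact hk.1 x i (by omega)
      · rfl
    · intro x y hxy
      have : B.seg n L x = B.seg n L y := seg_congr fun i _ hi => hxy i hi
      simp only [af]
      rw [this]
      split_ifs
      · exact (hk.mono B (show n ≤ n + L + 1 by omega)).2 x y hxy
      · exact hxy
  have hcancel : ∀ k k' : Equiv.Perm B.Path, B.IsLevel n k' → (∀ x, k (k' x) = x) →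
      ∀ x, af k (af k' x) = x := by
    intro k k' hk' hkk x
    by_cases hb : b (B.seg n L x) = true
    · simp only [af]
      rw [if_pos hb, hseg k' hk', if_pos hb, hkk]
    · simp only [af]
      rw [if_neg hb, if_neg hb]
  let ap : Equiv.Perm B.Path :=
    { toFun := af g.1.1
      invFun := af g.1.1⁻¹
      left_inv := hcancel _ _ hg.1 (fun x => g.1.1.symm_apply_apply x)
      right_inv := hcancel _ _ hg.2 (fun x => g.1.1.apply_symm_apply x) }
  have hal : ap ∈ B.level (n + L + 1) := ⟨hafl _ hg.1, hafl _ hg.2⟩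
  have hapA : ∀ x ∈ A, ap x = x := by
    intro x hx
    change af g.1.1 x = x
    simp only [af]
    rw [hfix x hx, ite_self]
  let a : B.Gcirc A := ⟨⟨ap, ⟨_, hal⟩⟩, mem_Gcirc.2 hapA⟩
  let h : B.Gcirc A := ⟨⟨hp, ⟨_, hpl⟩⟩, mem_Gcirc.2 hfA⟩
  refine ⟨n + L + 1, by omega, a, h, hal, hpl, ?_, ?_⟩
  · apply Subtype.ext
    apply Subtype.ext
    ext x
    change g.1.1 x = af g.1.1 (hf (af g.1.1 (hf x)))
    by_cases hx : x ∈ A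
    · have e1 : af g.1.1 x = x := hapA x hx
      rw [hfA x hx, e1, hfA x hx, e1, hfix x hx]
    · by_cases hb : b (B.seg n L x) = true
      · have e1 : af g.1.1 (hf x) = hf x := by
          simp only [af]
          rw [hfN x hx, hY2, hbι, hb]
          simp
        rw [e1, hinv x]
        simp only [af]
        rw [if_pos hb]
      · have e1 : af g.1.1 (hf x) = g.1.1 (Y x) := by
          simp only [af]
          rw [hfN x hx, hY2, hbι]
          simp [hb]
        have hN : g.1.1 (Y x) ∉ A := notMem_of_fix _ hfix _ (hYN x hx)
        have e2 : hf (g.1.1 (Y x)) = g.1.1 x := by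
          rw [hfN _ hN]
          refine path_ext₃ n L ((hY1 _).trans (hlev _ _ (hY1 x))) ?_ (fun i hi => ?_)
          · rw [hY2, hseg _ hg.1, hY2, hιι, hseg _ hg.1]
          · rw [hY3 _ i hi, hg.1.1 _ i (by omega), hY3 _ i hi, hg.1.1 _ i (by omega)]
        rw [e1, e2]
        simp only [af]
        rw [hseg _ hg.1, if_neg hb]
  · apply Subtype.ext
    apply Subtype.ext
    ext x
    exact hinv x

theorem hom_trivial {B : BratteliDiagram} (heven : B.IsEven) {A : Set B.Path} (hA : IsClopen A)
    (hne : A ≠ Set.univ) {Q : Type*} [Group Q] [Finite Q] (f : B.Gcirc A →* Q)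
    (g : B.Gcirc A) : f g = 1 := by
  obtain ⟨n₀, hn₀⟩ := B.exists_sat A hA
  obtain ⟨ι, n₁, hfin, hcard, hn₁, hbig⟩ := B.exists_big heven hne hn₀ (Nat.card Q + 2)
  obtain ⟨n₂, hg⟩ := g.1.2
  have hs : B.Sat (max n₁ n₂) A := hn₀.mono (hn₁.trans (le_max_left _ _))
  obtain ⟨m, hm, a, h, ha, hh, hgah, hh1⟩ :=
    exists_decomp heven hs g (B.level_mono (le_max_right n₁ n₂) hg)
  have hbm : B.Big A ι m := hbig.mono ((le_max_left _ _).trans hm) (hn₀.mono hn₁)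
  obtain ⟨h1, h2⟩ := image_comm (hs.mono hm) hcard hbm f a h ha hh
  have h3 : f h * f h = 1 := by rw [← map_mul, hh1, map_one]
  rw [hgah]
  simp only [map_mul]
  rw [← h1, mul_assoc (f a) (f h), h3, mul_one, h2]

theorem relIndex_Gcirc {B : BratteliDiagram} (heven : B.IsEven) {A : Set B.Path}
    (hA : IsClopen A) (hne : A ≠ Set.univ) (N : Subgroup B.fullGroup)
    (hN : N.relIndex (B.Gcirc A) ≠ 0) : B.Gcirc A ≤ N := by
  intro g hg
  have : (N.subgroupOf (B.Gcirc A)).FiniteIndex := ⟨hN⟩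
  have h := hom_trivial heven hA hne
    (QuotientGroup.mk' (N.subgroupOf (B.Gcirc A)).normalCore) ⟨g, hg⟩
  rw [QuotientGroup.mk'_apply, QuotientGroup.eq_one_iff] at h
  exact Subgroup.normalCore_le (N.subgroupOf (B.Gcirc A)) h

end BratteliDiagram

/-- for a proper clopen set `A` and an IRS `φ`, the averages over
`G°_n(A) = G_n ∩ G°(A)` of `φ(Fix_{Sub(G)}(g))` converge monotonically to `φ(F(A))`. -/
theorem average_fixed_subgroups_tendsto_FF (B : BratteliDiagram)
    (hsimple : B.IsSimple) (heven : B.IsEven)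
    (A : Set B.Path) (hA : IsClopen A) (hAne : A ≠ Set.univ)
    (φ : Measure (Subgroup ↥B.fullGroup)) (hφ : IsIRS ↥B.fullGroup φ) :
    Filter.Tendsto
      (fun n : ℕ =>
        (∑ᶠ g : ↥(B.GcircN n A),
            (φ {H : Subgroup ↥B.fullGroup | conjSub (g : ↥B.fullGroup) H = H}).toReal)
          / (Nat.card ↥(B.GcircN n A) : ℝ))
      Filter.atTop
      (nhds ((φ (B.FF A)).toReal)) ∧
    Antitone (fun n : ℕ =>
        (∑ᶠ g : ↥(B.GcircN n A),
            (φ {H : Subgroup ↥B.fullGroup | conjSub (g : ↥B.fullGroup) H = H}).toReal)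
          / (Nat.card ↥(B.GcircN n A) : ℝ)) := by
  have := hφ.1
  exact abstract_average (fun n => B.GcircN n A)
    (fun a b hab => inf_le_inf_right _ (Subgroup.comap_mono (B.level_mono hab)))
    (B.Gcirc A) (fun n => inf_le_right)
    (fun g hg => by
      obtain ⟨n, hn⟩ := g.2
      exact ⟨n, hn, hg⟩)
    (fun n => by
      have := B.finite_levelIn n
      exact Finite.of_injective _ (Subgroup.inclusion_injective
        (inf_le_left : B.GcircN n A ≤ B.levelIn n)))
    (fun N hN => BratteliDiagram.relIndex_Gcirc heven hA hAne N hN) φ
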